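/- Suppose the system (φ₁,…,φₙ) satisfies the open convex set condition and the interior of K̃ = convexHull ℝ K is nonempty. For each i let Qᵢ = φᵢ(K̃) ∩ frontier K̃. Then each Qᵢ has finitely many connected components, and the total number of connected components of Q₁,…,Qₙ is at most 2n − 2. -/

import Mathlib

open Set

/-- A compatible family of partitions of the complements of the points of a finite set has a leaf:
a point whose partition has a single class. -/
theorem exists_forall_apply_eq_of_compatible {ι X : Type*} [DecidableEq ι] (g : ι → ι → X)
    (hg : ∀ i j k, i ≠ j → i ≠ k → j ≠ k → g i k = g i j ∨ g j k = g j i)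
    (s : Finset ι) (hs : 1 < s.card) :
    ∃ j ∈ s, ∃ i ∈ s, ∀ k ∈ s, k ≠ j → g j k = g j i := by
  classical
  obtain ⟨a, ha, b, hb, hab⟩ := Finset.one_lt_card.1 hs
  obtain ⟨⟨i, j⟩, hij, hmin⟩ := Finset.exists_min_image s.offDiag
    (fun p => (s.filter fun k => k ≠ p.1 ∧ g p.1 k = g p.1 p.2).card)
    ⟨(a, b), by simp [ha, hb, hab]⟩
  obtain ⟨hi, hj, hne⟩ := Finset.mem_offDiag.1 hij
  refine ⟨j, hj, i, hi, fun k hk hkj => ?_⟩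
  by_contra hcon
  refine absurd (hmin (j, k) (by simp [hj, hk, hkj.symm])) (not_le.2 (Finset.card_lt_card ?_))
  refine Finset.ssubset_iff_of_subset (fun l hl => ?_) |>.2 ⟨j, ?_, ?_⟩
  · simp only [Finset.mem_filter] at hl ⊢
    obtain ⟨hls, hlj, hl⟩ := hl
    have hli : l ≠ i := by
      rintro rfl
      exact hcon hl.symm
    refine ⟨hls, hli, (hg i j l hne hli.symm hlj.symm).resolve_right fun h => hcon (hl ▸ h)⟩
  · simpa [hj] using Ne.symm hne
  · simp

/-- A family of partitions of the complements of the points of a finite set, any two of which are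
compatible, has at most as many classes as a tree has pairs of an edge and an endpoint. -/
theorem sum_card_image_erase_le {ι X : Type*} [DecidableEq ι] [DecidableEq X] (g : ι → ι → X)
    (hg : ∀ i j k, i ≠ j → i ≠ k → j ≠ k → g i k = g i j ∨ g j k = g j i)
    (s : Finset ι) (hs : s.Nonempty) :
    ∑ i ∈ s, ((s.erase i).image (g i)).card ≤ 2 * (s.card - 1) := by
  induction hm : s.card generalizing s with
  | zero => simp_all
  | succ m ih =>
    rcases Nat.eq_zero_or_pos m with rfl | hmpos
    · obtain ⟨a, rfl⟩ := Finset.card_eq_one.1 hm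
      simp
    obtain ⟨j, hj, i₀, -, hleaf⟩ := exists_forall_apply_eq_of_compatible g hg s (by omega)
    have hcard : (s.erase j).card = m := by rw [Finset.card_erase_of_mem hj, hm]; rfl
    have hrec := ih (s.erase j) (Finset.card_pos.1 (by omega)) hcard
    have hone : ((s.erase j).image (g j)).card ≤ 1 := by
      rw [Finset.card_le_one]
      intro a ha b hb
      obtain ⟨k, hk, rfl⟩ := Finset.mem_image.1 ha
      obtain ⟨l, hl, rfl⟩ := Finset.mem_image.1 hb
      rw [Finset.mem_erase] at hk hl
      rw [hleaf k hk.2 hk.1, hleaf l hl.2 hl.1]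
    set B := (s.erase j).filter fun i => ∀ k ∈ s, k ≠ i → k ≠ j → g i k ≠ g i j with hB
    have hBcard : B.card ≤ 1 := by
      rw [Finset.card_le_one]
      intro a ha b hb
      simp only [hB, Finset.mem_filter, Finset.mem_erase] at ha hb
      by_contra hab
      rcases hg a b j hab ha.1.1 hb.1.1 with h | h
      · exact ha.2 b hb.1.2 (Ne.symm hab) hb.1.1 h.symm
      · exact hb.2 a ha.1.2 hab ha.1.1 h.symm
    have hstep : ∀ i ∈ s.erase j, ((s.erase i).image (g i)).card ≤
        (((s.erase j).erase i).image (g i)).card + if i ∈ B then 1 else 0 := by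
      intro i hi
      have hij : j ∈ s.erase i := by
        rw [Finset.mem_erase] at hi ⊢
        exact ⟨hi.1.symm, hj⟩
      have hins : s.erase i = insert j ((s.erase j).erase i) := by
        rw [Finset.erase_right_comm, Finset.insert_erase hij]
      split_ifs with hiB
      · rw [hins, Finset.image_insert]
        exact Finset.card_insert_le _ _
      · rw [hins, Finset.image_insert, Finset.insert_eq_of_mem, add_zero]
        simp only [hB, Finset.mem_filter, hi, true_and] at hiB
        push Not at hiB
        obtain ⟨k, hk, hki, hkj, h⟩ := hiB
        exact Finset.mem_image.2 ⟨k, by simp [hk, hki, hkj], h⟩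
    have hsum := Finset.sum_le_sum hstep
    rw [Finset.sum_add_distrib, Finset.sum_ite_mem, Finset.sum_const, smul_eq_mul,
      mul_one] at hsum
    have hinter := Finset.card_le_card (Finset.inter_subset_right : s.erase j ∩ B ⊆ B)
    rw [← Finset.add_sum_erase s _ hj]
    omega

/-- On a ray issuing from an interior point of `C` which meets the frontier of `C` in a point of the
convex set `E`, all points of `C` belong to `E`. -/
theorem circleMap_mem_of_mem_frontier {C E : Set ℂ} {o : ℂ} (hC : Convex ℝ C)
    (ho : o ∈ interior C) (hE : Convex ℝ E) (hoE : o ∈ E) {r c t : ℝ}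
    (hrC : circleMap o r t ∈ frontier C) (hrE : circleMap o r t ∈ E) (hr : 0 < r) (hc : 0 ≤ c)
    (hcC : circleMap o c t ∈ C) : circleMap o c t ∈ E := by
  have hr0 : (r : ℂ) ≠ 0 := by exact_mod_cast hr.ne'
  rcases le_or_gt c r with hcr | hcr
  · have : circleMap o c t = (1 - c / r) • o + (c / r) • circleMap o r t := by
      simp only [circleMap, Complex.real_smul]
      push_cast
      field_simp
      ring
    rw [this]
    exact hE hoE hrE (sub_nonneg.2 ((div_le_one hr).2 hcr)) (by positivity) (by ring)
  · exfalso
    have hc0 : (c : ℂ) ≠ 0 := by exact_mod_cast (hr.trans hcr).ne'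
    have : circleMap o r t = (1 - r / c) • o + (r / c) • circleMap o c t := by
      simp only [circleMap, Complex.real_smul]
      push_cast
      field_simp
      ring
    refine hrC.2 (this ▸ hC.combo_interior_self_mem_interior ho hcC
      (sub_pos.2 ((div_lt_one (hr.trans hcr)).2 hcr)) ?_ (by ring))
    have := hr.trans hcr
    positivity

/-- The frontier of a planar convex body is the graph, in polar coordinates around an interior
point, of a continuous function. -/
theorem exists_polar_frontier {C : Set ℂ} {o : ℂ} (hC : Convex ℝ C) (hCc : IsCompact C)
    (ho : o ∈ interior C) :
    ∃ ρ : ℝ → ℝ, Continuous ρ ∧ (∀ t, 0 < ρ t) ∧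
      ∀ t r, 0 < r → (circleMap o r t ∈ frontier C ↔ r = ρ t) := by
  let e : ℂ ≃ₜ ℂ := Homeomorph.addLeft o
  set D : Set ℂ := e ⁻¹' C with hD
  have hDc : IsCompact D := e.isCompact_preimage.2 hCc
  have hDconv : Convex ℝ D := hC.translate_preimage_right o
  have hD0 : D ∈ nhds (0 : ℂ) := by
    refine e.continuous.continuousAt.preimage_mem_nhds ?_
    simpa [e] using mem_interior_iff_mem_nhds.1 ho
  have hfr : ∀ z, o + z ∈ frontier C ↔ gauge D z = 1 := by
    intro z
    rw [gauge_eq_one_iff_mem_frontier hDconv hD0, hD, ← e.preimage_frontier]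
    rfl
  have hpos : ∀ t : ℝ, 0 < gauge D (Complex.exp (t * Complex.I)) := fun t =>
    (gauge_pos (absorbent_nhds_zero hD0)
      (NormedSpace.isVonNBounded_of_isBounded ℝ hDc.isBounded)).2 (Complex.exp_ne_zero _)
  refine ⟨fun t => (gauge D (Complex.exp (t * Complex.I)))⁻¹, ?_, fun t => inv_pos.2 (hpos t), ?_⟩
  · exact Continuous.inv₀ ((continuous_gauge hDconv hD0).comp (by fun_prop))
      fun t => (hpos t).ne'
  · intro t r hr
    rw [circleMap, hfr, ← Complex.real_smul, gauge_smul_of_nonneg hr.le, smul_eq_mul,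
      ← mul_eq_one_iff_eq_inv₀ (hpos t).ne']

theorem exists_mem_Ioc_circleMap (o p : ℂ) (t₀ : ℝ) :
    ∃ t ∈ Ioc t₀ (t₀ + 2 * Real.pi), circleMap o ‖p - o‖ t = p := by
  refine ⟨toIocMod Real.two_pi_pos t₀ (Complex.arg (p - o)), toIocMod_mem_Ioc _ _ _, ?_⟩
  rw [toIocMod, (periodic_circleMap o _).sub_zsmul_eq, circleMap, Complex.norm_mul_exp_arg_mul_I]
  ring

/-- Two points of `C \ E` lying in directions separated by the directions of two common points of `E`
and the frontier of `C` belong to different components of `C \ E`. -/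
theorem notMem_connectedComponentIn_of_alternating {C E : Set ℂ} {o : ℂ} (hC : Convex ℝ C)
    (ho : o ∈ interior C) (hE : Convex ℝ E) (hoE : o ∈ E) {r₁ r₂ r₃ r₄ t₁ s₁ t₂ s₂ : ℝ}
    (hr₁ : 0 < r₁) (hr₂ : 0 < r₂) (hr₃ : 0 < r₃) (hr₄ : 0 < r₄)
    (h₁C : circleMap o r₁ t₁ ∈ frontier C) (h₁E : circleMap o r₁ t₁ ∈ E)
    (h₂C : circleMap o r₂ t₂ ∈ frontier C) (h₂E : circleMap o r₂ t₂ ∈ E)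
    (h₃ : circleMap o r₃ s₁ ∈ C \ E)
    (h12 : t₁ < s₁) (h23 : s₁ < t₂) (h34 : t₂ < s₂) (h41 : s₂ < t₁ + 2 * Real.pi) :
    circleMap o r₄ s₂ ∉ connectedComponentIn (C \ E) (circleMap o r₃ s₁) := by
  intro hmem
  set S := connectedComponentIn (C \ E) (circleMap o r₃ s₁) with hS
  have hSsub : S ⊆ C \ E := connectedComponentIn_subset _ _
  let w : ℂ → ℂ := fun p => -((p - o) * Complex.exp (-(t₁ * Complex.I)))
  have hwcont : Continuous w := by fun_prop
  have hwp : ∀ r t : ℝ, w (circleMap o r t) =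
      r * Complex.exp ((t - t₁ - Real.pi : ℝ) * Complex.I) := by
    intro r t
    have : Complex.exp ((t - t₁ - Real.pi : ℝ) * Complex.I) =
        -(Complex.exp (t * Complex.I) * Complex.exp (-(t₁ * Complex.I))) := by
      rw [← Complex.exp_add, ← neg_one_mul, ← Complex.exp_neg_pi_mul_I, ← Complex.exp_add]
      congr 1
      push_cast
      ring
    rw [this]
    simp only [w, circleMap]
    ring
  have harg : ∀ r t : ℝ, 0 < r → t₁ < t → t < t₁ + 2 * Real.pi →
      Complex.arg (w (circleMap o r t)) = t - t₁ - Real.pi := by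
    intro r t hr h h'
    rw [hwp, Complex.arg_real_mul _ hr, Complex.arg_exp_mul_I, toIocMod_eq_self]
    constructor <;> linarith
  have hpolar : ∀ p, ∀ θ : ℝ, Complex.arg (w p) = θ - t₁ - Real.pi → p = circleMap o ‖w p‖ θ := by
    intro p θ h
    have h1 := Complex.norm_mul_exp_arg_mul_I (w p)
    rw [h, ← hwp] at h1
    have h2 : Function.Injective w := by
      intro a b hab
      simpa [w, Complex.exp_ne_zero] using hab
    exact (h2 h1).symm
  have hslit : ∀ p ∈ S, w p ∈ Complex.slitPlane := by
    intro p hp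
    have key : ∀ c : ℝ, 0 ≤ c → p ≠ circleMap o c t₁ := by
      rintro c hc rfl
      exact (hSsub hp).2 (circleMap_mem_of_mem_frontier hC ho hE hoE h₁C h₁E hr₁ hc (hSsub hp).1)
    rw [Complex.mem_slitPlane_iff_arg]
    constructor
    · intro h
      refine key ‖w p‖ (norm_nonneg _) ?_
      rw [← (periodic_circleMap o _) t₁]
      exact hpolar p _ (by rw [h]; ring)
    · intro h
      refine key 0 le_rfl ?_
      simpa [w, Complex.exp_ne_zero, sub_eq_zero] using h
  have hpre : IsPreconnected ((fun p => Complex.arg (w p)) '' S) :=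
    isPreconnected_connectedComponentIn.image _
      (Complex.continuousOn_arg.comp hwcont.continuousOn hslit)
  have hsub := hpre.Icc_subset (mem_image_of_mem _ (mem_connectedComponentIn h₃))
    (mem_image_of_mem _ hmem)
  simp only [harg r₃ s₁ hr₃ h12 (by linarith), harg r₄ s₂ hr₄ (by linarith) h41] at hsub
  obtain ⟨p, hp, hpt⟩ := hsub (show t₂ - t₁ - Real.pi ∈ _ by constructor <;> linarith)
  have hpe := hpolar p t₂ hpt
  refine (hSsub hp).2 ?_
  rw [hpe]
  exact circleMap_mem_of_mem_frontier hC ho hE hoE h₂C h₂E hr₂ (norm_nonneg _)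
    (hpe ▸ (hSsub hp).1)

theorem mk_eq_mk_of_forall_mem_Icc {X : Type*} [TopologicalSpace X] {Q : Set X} {γ : ℝ → X}
    (hγ : Continuous γ) {a b : ℝ} (hab : a ≤ b) (h : ∀ t ∈ Icc a b, γ t ∈ Q) :
    (ConnectedComponents.mk (⟨γ a, h a (left_mem_Icc.2 hab)⟩ : Q)) =
      ConnectedComponents.mk ⟨γ b, h b (right_mem_Icc.2 hab)⟩ := by
  have : PreconnectedSpace (Icc a b) := Subtype.preconnectedSpace isPreconnected_Icc
  let f : Icc a b → Q := fun t => ⟨γ t, h t t.2⟩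
  have hf : Continuous f := (hγ.comp continuous_subtype_val).subtype_mk _
  rw [ConnectedComponents.coe_eq_coe']
  exact (isPreconnected_range hf).subset_connectedComponent
    (mem_range_self (⟨b, right_mem_Icc.2 hab⟩ : Icc a b))
    (mem_range_self (⟨a, left_mem_Icc.2 hab⟩ : Icc a b))

theorem finite_and_card_le_of_forall_finset {α : Type*} {c : ℕ}
    (h : ∀ T : Finset α, T.card ≤ c) : Finite α ∧ Nat.card α ≤ c := by
  have hfin : Finite α := by
    by_contra hinf
    rw [not_finite_iff_infinite] at hinf
    obtain ⟨T, hT⟩ := Infinite.exists_subset_card_eq α (c + 1)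
    have := h T
    omega
  refine ⟨hfin, ?_⟩
  have := Fintype.ofFinite α
  rw [Nat.card_eq_fintype_card]
  exact h Finset.univ

/-- The trace of a convex body `E` on the frontier of a larger convex body `C` has at most as many
components as there are components of `C \ E` which reach the frontier of `C`. -/
theorem card_components_inter_frontier_le {C E : Set ℂ} {o a : ℂ} (hC : Convex ℝ C)
    (hCc : IsCompact C) (hE : Convex ℝ E) (hEC : E ⊆ C) (ho : o ∈ interior E) (ha : a ∈ C \ E)
    (W : Finset (Set ℂ))
    (hW : ∀ u ∈ frontier C \ E, connectedComponentIn (C \ E) u ∈ W) :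
    Finite (ConnectedComponents ↑(E ∩ frontier C)) ∧
      Nat.card (ConnectedComponents ↑(E ∩ frontier C)) ≤ W.card := by
  have hoC : o ∈ interior C := interior_mono hEC ho
  have hoE : o ∈ E := interior_subset ho
  obtain ⟨ρ, hρ, hρpos, hρfr⟩ := exists_polar_frontier hC hCc hoC
  set γ : ℝ → ℂ := fun t => circleMap o (ρ t) t with hγ
  have hγcont : Continuous γ := by
    simp only [hγ, circleMap]
    fun_prop
  have hγfr : ∀ t, γ t ∈ frontier C := fun t => (hρfr t _ (hρpos t)).2 rfl
  have hγC : ∀ t, γ t ∈ C := fun t => hCc.isClosed.frontier_subset (hγfr t)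
  have hsurj : ∀ p ∈ frontier C, ∀ t₀, ∃ t ∈ Ioc t₀ (t₀ + 2 * Real.pi), γ t = p := by
    intro p hp t₀
    obtain ⟨t, ht, htp⟩ := exists_mem_Ioc_circleMap o p t₀
    refine ⟨t, ht, ?_⟩
    have hpos : 0 < ‖p - o‖ := by
      rw [norm_pos_iff, sub_ne_zero]
      rintro rfl
      exact hp.2 hoC
    simp only [hγ]
    rw [← (hρfr t _ hpos).1 (htp.symm ▸ hp), htp]
  have hper : ∀ t, γ (t + 2 * Real.pi) = γ t := by
    intro t
    have h := hγfr t
    simp only [hγ] at h ⊢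
    rw [← periodic_circleMap, hρfr _ _ (hρpos t)] at h
    rw [← h, periodic_circleMap]
  obtain ⟨t₀, ht₀⟩ : ∃ t₀, γ t₀ ∉ E := by
    obtain ⟨t, -, ht⟩ := exists_mem_Ioc_circleMap o a 0
    refine ⟨t, fun h => ha.2 ?_⟩
    rw [← ht]
    exact circleMap_mem_of_mem_frontier hC hoC hE hoE (hγfr t) h (hρpos t) (norm_nonneg _)
      (ht.symm ▸ ha.1)
  have hτ : ∀ κ : ConnectedComponents ↑(E ∩ frontier C), ∃ t ∈ Ioo t₀ (t₀ + 2 * Real.pi),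
      ∃ h : γ t ∈ E ∩ frontier C, ConnectedComponents.mk ⟨γ t, h⟩ = κ := by
    intro κ
    obtain ⟨⟨x, hx⟩, rfl⟩ := ConnectedComponents.surjective_coe κ
    obtain ⟨t, ht, rfl⟩ := hsurj x hx.2 t₀
    refine ⟨t, ⟨ht.1, ht.2.lt_of_ne ?_⟩, hx, rfl⟩
    rintro rfl
    exact ht₀ (hper t₀ ▸ hx.1)
  choose τ hτIoo hτQ hτκ using hτ
  have hτinj : ∀ κ κ', τ κ = τ κ' → κ = κ' := by
    intro κ κ' h
    rw [← hτκ κ, ← hτκ κ']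
    congr 2
    rw [h]
  refine finite_and_card_le_of_forall_finset fun T => ?_
  have hu : ∀ κ, ∃ u, τ κ < u ∧ u ≤ t₀ + 2 * Real.pi ∧ γ u ∉ E ∧
      ∀ κ' ∈ T, τ κ < τ κ' → u < τ κ' := by
    intro κ
    rcases (T.filter fun κ' => τ κ < τ κ').eq_empty_or_nonempty with hT | hT
    · refine ⟨_, (hτIoo κ).2, le_rfl, hper t₀ ▸ ht₀, fun κ' hκ' h => ?_⟩
      exact absurd hT (Finset.ne_empty_of_mem (Finset.mem_filter.2 ⟨hκ', h⟩))
    · obtain ⟨κ', hκ', hmin⟩ := Finset.exists_min_image _ τ hT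
      have hlt := (Finset.mem_filter.1 hκ').2
      obtain ⟨u, hu, huE⟩ : ∃ u ∈ Icc (τ κ) (τ κ'), γ u ∉ E := by
        by_contra! hcon
        have := mk_eq_mk_of_forall_mem_Icc (Q := E ∩ frontier C) hγcont hlt.le
          fun t ht => ⟨hcon t ht, hγfr t⟩
        rw [hτκ, hτκ] at this
        exact hlt.ne (congrArg τ this)
      have h1 : τ κ ≠ u := by
        rintro rfl
        exact huE (hτQ κ).1
      have h2 : u ≠ τ κ' := by
        rintro rfl
        exact huE (hτQ κ').1
      have h3 : u < τ κ' := hu.2.lt_of_ne h2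
      exact ⟨u, hu.1.lt_of_ne h1, (h3.trans (hτIoo κ').2).le, huE, fun κ'' hκ'' h =>
        h3.trans_le (hmin κ'' (Finset.mem_filter.2 ⟨hκ'', h⟩))⟩
  choose u huτ huπ huE huT using hu
  have hne : ∀ κ ∈ T, ∀ κ' ∈ T, τ κ < τ κ' → connectedComponentIn (C \ E) (γ (u κ)) ≠
      connectedComponentIn (C \ E) (γ (u κ')) := by
    intro κ _ κ' hκ' hlt heq
    have hmem : γ (u κ') ∈ connectedComponentIn (C \ E) (γ (u κ)) := by
      rw [heq]
      exact mem_connectedComponentIn ⟨hγC (u κ'), huE κ'⟩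
    refine notMem_connectedComponentIn_of_alternating hC hoC hE hoE (hρpos _) (hρpos _) (hρpos _)
      (hρpos _) (hγfr (τ κ)) (hτQ κ).1 (hγfr (τ κ')) (hτQ κ').1 ⟨hγC (u κ), huE κ⟩ (huτ κ)
      (huT κ κ' hκ' hlt) (huτ κ') ?_ hmem
    linarith [huπ κ', (hτIoo κ).1]
  refine Finset.card_le_card_of_injOn (fun κ => connectedComponentIn (C \ E) (γ (u κ)))
    (fun κ _ => hW _ ⟨hγfr _, huE κ⟩) fun κ hκ κ' hκ' h => ?_
  rcases lt_trichotomy (τ κ) (τ κ') with hlt | heq | hlt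
  · exact absurd h (hne κ hκ κ' hκ' hlt)
  · exact hτinj _ _ heq
  · exact absurd h.symm (hne κ' hκ' κ hκ hlt)

theorem connectedComponentIn_eq_of_segment_subset {F : Set ℂ} {p q : ℂ}
    (h : segment ℝ p q ⊆ F) : connectedComponentIn F p = connectedComponentIn F q :=
  connectedComponentIn_eq ((convex_segment p q).isPreconnected.subset_connectedComponentIn
    (left_mem_segment ℝ p q) h (right_mem_segment ℝ p q))

/-- If `n ≥ 2` convex bodies with disjoint interiors span the planar convex body `C`, then their
traces on the frontier of `C` have at most `2n - 2` components altogether. -/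
theorem sum_card_components_inter_frontier_le {ι : Type*} [Fintype ι]
    (hι : 2 ≤ Fintype.card ι) {C : Set ℂ} (hC : Convex ℝ C) (hCc : IsCompact C) {B : ι → Set ℂ}
    (hB : ∀ i, Convex ℝ (B i)) (hBc : ∀ i, IsCompact (B i))
    (hBne : ∀ i, (interior (B i)).Nonempty)
    (hdisj : ∀ i j, i ≠ j → Disjoint (interior (B i)) (interior (B j)))
    (hBC : ∀ i, B i ⊆ C) (hCB : C ⊆ convexHull ℝ (⋃ i, B i)) :
    (∀ i, Finite (ConnectedComponents ↑(B i ∩ frontier C))) ∧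
      ∑ i, Nat.card (ConnectedComponents ↑(B i ∩ frontier C)) ≤ 2 * (Fintype.card ι - 1) := by
  classical
  choose v hv using hBne
  have hclos : ∀ i, B i ⊆ closure (interior (B i)) := fun i => by
    rw [(hB i).closure_interior_eq_closure_of_nonempty_interior ⟨v i, hv i⟩]
    exact subset_closure
  have hnot : ∀ i j, i ≠ j → ∀ w ∈ interior (B j), w ∉ B i := fun i j hij w hw hwi =>
    disjoint_left.1 ((hdisj j i hij.symm).closure_right isOpen_interior) hw (hclos i hwi)
  have hvC : ∀ i, v i ∈ C := fun i => hBC i (interior_subset (hv i))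
  let g : ι → ι → Set ℂ := fun i j => connectedComponentIn (C \ B i) (v j)
  have hcompat : ∀ i j k, i ≠ j → i ≠ k → j ≠ k → g i k = g i j ∨ g j k = g j i := by
    intro i j k hij hik hjk
    by_contra! hcon
    obtain ⟨f, c, hfi, hfj⟩ := geometric_hahn_banach_open_open (hB i).interior isOpen_interior
      (hB j).interior isOpen_interior (hdisj i j hij)
    have hfi' : ∀ x ∈ B i, f x ≤ c := fun x hx =>
      closure_minimal (t := {x | f x ≤ c}) (fun y hy => (hfi y hy).le)
        (isClosed_le f.continuous continuous_const) (hclos i hx)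
    have hfj' : ∀ x ∈ B j, c ≤ f x := fun x hx =>
      closure_minimal (t := {x | c ≤ f x}) (fun y hy => (hfj y hy).le)
        (isClosed_le continuous_const f.continuous) (hclos j hx)
    have hfk : c < f (v k) := by
      by_contra! hle
      refine hcon.2 (connectedComponentIn_eq_of_segment_subset fun x hx =>
        ⟨hC.segment_subset (hvC k) (hvC i) hx, fun hxj => ?_⟩)
      obtain ⟨s, t, hs, ht, hst, rfl⟩ := hx
      have h1 := hfj' _ hxj
      rw [map_add, map_smul, map_smul, smul_eq_mul, smul_eq_mul] at h1
      have h2 := hfi _ (hv i)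
      rcases ht.eq_or_lt with rfl | ht
      · obtain rfl : s = 1 := by linarith
        rw [one_smul, zero_smul, add_zero] at hxj
        exact hnot j k hjk _ (hv k) hxj
      · obtain rfl : s = 1 - t := by linarith
        nlinarith
    refine hcon.1 (connectedComponentIn_eq_of_segment_subset fun x hx =>
      ⟨hC.segment_subset (hvC k) (hvC j) hx, fun hxi => ?_⟩)
    exact absurd (hfi' x hxi) (not_le.2 (((convex_Ioi c).is_linear_preimage
      (f := f) f.isBoundedLinearMap.toIsLinearMap).segment_subset hfk (hfj _ (hv j)) hx))
  have hcount : ∀ i, Finite (ConnectedComponents ↑(B i ∩ frontier C)) ∧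
      Nat.card (ConnectedComponents ↑(B i ∩ frontier C)) ≤
        ((Finset.univ.erase i).image (g i)).card := by
    intro i
    obtain ⟨j, hji⟩ := Fintype.exists_ne_of_one_lt_card (by omega) i
    refine card_components_inter_frontier_le hC hCc (hB i) (hBC i) (hv i)
      (a := v j) ⟨hvC j, hnot i j hji.symm _ (hv j)⟩ _ ?_
    rintro u ⟨huC, hui⟩
    replace huC := hCc.isClosed.frontier_subset huC
    obtain ⟨f, c, hfi, hfu⟩ := geometric_hahn_banach_closed_point (hB i) (hBc i).isClosed hui
    obtain ⟨k, y, hyk, hfy⟩ : ∃ k, ∃ y ∈ B k, c < f y := by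
      by_contra! hcon
      have : convexHull ℝ (⋃ i, B i) ⊆ {x | f x ≤ c} :=
        convexHull_min (iUnion_subset hcon)
          ((convex_Iic c).is_linear_preimage (f := f) f.isBoundedLinearMap.toIsLinearMap)
      exact absurd (this (hCB huC)) (not_le.2 hfu)
    have hki : k ≠ i := by
      rintro rfl
      exact absurd (hfi y hyk) (not_lt.2 hfy.le)
    obtain ⟨w, hfw, hwk⟩ := mem_closure_iff.1 (hclos k hyk) {x | c < f x}
      (isOpen_lt continuous_const f.continuous) hfy
    refine Finset.mem_image.2 ⟨k, by simpa using hki, ?_⟩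
    have h1 : g i k = connectedComponentIn (C \ B i) w :=
      connectedComponentIn_eq_of_segment_subset fun x hx => by
        have hx' := (hB k).interior.segment_subset (hv k) hwk hx
        exact ⟨hBC k (interior_subset hx'), hnot i k hki.symm x hx'⟩
    rw [h1]
    refine connectedComponentIn_eq_of_segment_subset fun x hx =>
      ⟨hC.segment_subset (hBC k (interior_subset hwk)) huC hx, fun hxi => ?_⟩
    exact absurd (hfi x hxi) (not_lt.2 (le_of_lt (((convex_Ioi c).is_linear_preimage
      (f := f) f.isBoundedLinearMap.toIsLinearMap).segment_subset hfw hfu hx)))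
  refine ⟨fun i => (hcount i).1, (Finset.sum_le_sum fun i _ => (hcount i).2).trans ?_⟩
  exact sum_card_image_erase_le g hcompat Finset.univ
    (Finset.card_pos.1 (by rw [Finset.card_univ]; omega))

/-- The attractor of a contracting iterated function system lies in the closure of every nonempty
forward invariant set. -/
theorem attractor_subset_closure {ι : Type*} {φ : ι → ℂ → ℂ} {q : ι → ℝ}
    (hq : ∀ i, 0 < q i ∧ q i < 1) (hφ : ∀ i x y, dist (φ i x) (φ i y) = q i * dist x y)
    {K O : Set ℂ} (hKc : IsCompact K) (hK : K ⊆ ⋃ i, φ i '' K) (hO : O.Nonempty)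
    (hφO : ∀ i, MapsTo (φ i) O O) : K ⊆ closure O := by
  rcases K.eq_empty_or_nonempty with rfl | hKne
  · simp
  obtain ⟨x, hx, hmax⟩ := hKc.exists_isMaxOn hKne (Metric.continuous_infDist_pt O).continuousOn
  obtain ⟨i, y, hy, rfl⟩ := mem_iUnion.1 (hK hx)
  have hle : Metric.infDist (φ i y) O ≤ q i * Metric.infDist y O := by
    rw [← div_le_iff₀' (hq i).1]
    refine (Metric.le_infDist hO).2 fun z hz => ?_
    rw [div_le_iff₀' (hq i).1, ← hφ]
    exact Metric.infDist_le_dist_of_mem (hφO i hz)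
  have hyx : Metric.infDist y O ≤ Metric.infDist (φ i y) O := hmax hy
  have h0 : Metric.infDist (φ i y) O ≤ 0 := by
    nlinarith [(hq i).1, (hq i).2, Metric.infDist_nonneg (x := φ i y) (s := O)]
  intro z hz
  rw [Metric.mem_closure_iff_infDist_zero hO]
  exact le_antisymm ((hmax hz).trans h0) Metric.infDist_nonneg

/-- By Carathéodory's theorem, the convex hull of a compact set in a finite-dimensional space is
compact. -/
theorem isCompact_convexHull_of_finiteDimensional {E : Type*} [NormedAddCommGroup E]
    [NormedSpace ℝ E] [FiniteDimensional ℝ E] {K : Set E} (hK : IsCompact K) :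
    IsCompact (convexHull ℝ K) := by
  let S : ℕ → Set E := fun m => (fun p : (Fin m → ℝ) × (Fin m → E) => ∑ i, p.1 i • p.2 i) ''
    (stdSimplex ℝ (Fin m) ×ˢ univ.pi fun _ => K)
  have hS : ∀ m, IsCompact (S m) := fun m =>
    ((isCompact_stdSimplex ℝ (Fin m)).prod (isCompact_univ_pi fun _ => hK)).image (by fun_prop)
  have heq : convexHull ℝ K = ⋃ m ∈ Finset.range (Module.finrank ℝ E + 2), S m := by
    refine Subset.antisymm (fun x hx => ?_) ?_
    · obtain ⟨ι, _, z, w, hz, hind, hw, hsum, rfl⟩ := eq_pos_convex_span_of_mem_convexHull hx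
      have hcard : Fintype.card ι < Module.finrank ℝ E + 2 := by
        have := hind.card_le_finrank_succ
        have := Submodule.finrank_le (vectorSpan ℝ (range z))
        omega
      let e := (Fintype.equivFin ι).symm
      refine mem_iUnion₂.2 ⟨Fintype.card ι, Finset.mem_range.2 hcard, (w ∘ e, z ∘ e), ⟨⟨?_, ?_⟩, ?_⟩,
        ?_⟩
      · exact fun i => (hw _).le
      · exact (Equiv.sum_comp e w).trans hsum
      · exact fun i _ => hz (mem_range_self _)
      · exact Equiv.sum_comp e fun i => w i • z i
    · refine iUnion₂_subset fun m _ => ?_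
      rintro _ ⟨⟨w, z⟩, ⟨hw, hz⟩, rfl⟩
      exact (convex_convexHull ℝ K).sum_mem (fun i _ => hw.1 i) hw.2
        fun i hi => subset_convexHull ℝ K (hz i (mem_univ i))
  rw [heq]
  exact (Finset.range _).isCompact_biUnion fun m _ => hS m

/-- Proposition 4, part 1: under the open convex set condition, each set
`Qᵢ = φᵢ(K̃) ∩ frontier K̃` has finitely many connected components, and the total number
of components is at most `2n - 2`. -/
theorem components_Qi_ocsc
    (n : ℕ) (hn : 2 ≤ n)
    (qs αs : Fin n → ℝ) (zs : Fin n → ℂ)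
    (hqs : ∀ i, 0 < qs i ∧ qs i < 1)
    (φ : Fin n → ℂ → ℂ)
    (hφ : ∀ i z, φ i z = (qs i : ℂ) * Complex.exp (Complex.I * (αs i : ℂ)) * (z - zs i) + zs i)
    (K : Set ℂ) (hKne : K.Nonempty) (hKc : IsCompact K)
    (hKinv : K = ⋃ i, φ i '' K)
    (hOCSC : ∃ O : Set ℂ, O.Nonempty ∧ IsOpen O ∧ Convex ℝ O ∧
      (⋃ i, φ i '' O) ⊆ O ∧ ∀ i j, i ≠ j → φ i '' O ∩ φ j '' O = ∅)
    (hint : (interior (convexHull ℝ K)).Nonempty)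
    (Q : Fin n → Set ℂ)
    (hQ : ∀ i, Q i = φ i '' (convexHull ℝ K) ∩ frontier (convexHull ℝ K)) :
    (∀ i, Finite (ConnectedComponents (Q i))) ∧
      ∑ i, Nat.card (ConnectedComponents (Q i)) ≤ 2 * n - 2 := by
  obtain ⟨O, hOne, hOo, hOconv, hOinv, hOdisj⟩ := hOCSC
  obtain rfl : Q = fun i => φ i '' (convexHull ℝ K) ∩ frontier (convexHull ℝ K) := funext hQ
  have hcoef : ∀ i, (qs i : ℂ) * Complex.exp (Complex.I * (αs i : ℂ)) ≠ 0 := fun i =>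
    mul_ne_zero (by exact_mod_cast (hqs i).1.ne') (Complex.exp_ne_zero _)
  have hhomeo : ∀ i, ∃ e : ℂ ≃ₜ ℂ, ⇑e = φ i := fun i =>
    ⟨((Homeomorph.subRight (zs i)).trans (Homeomorph.mulLeft₀ _ (hcoef i))).trans
      (Homeomorph.addRight (zs i)), funext fun z => by simp [hφ]⟩
  choose e he using hhomeo
  have haffine : ∀ i, ∃ A : ℂ →ᵃ[ℝ] ℂ, ⇑A = φ i := fun i =>
    ⟨(LinearMap.mulLeft ℝ ((qs i : ℂ) * Complex.exp (Complex.I * (αs i : ℂ)))).toAffineMap.comp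
      (AffineMap.id ℝ ℂ - AffineMap.const ℝ ℂ (zs i)) + AffineMap.const ℝ ℂ (zs i),
      funext fun z => by simp [hφ, mul_assoc]⟩
  choose A hA using haffine
  have hdist : ∀ i x y, dist (φ i x) (φ i y) = qs i * dist x y := by
    intro i x y
    rw [hφ, hφ, dist_add_right, dist_eq_norm, ← mul_sub, sub_sub_sub_cancel_right, norm_mul,
      norm_mul, mul_comm Complex.I, Complex.norm_exp_ofReal_mul_I, Complex.norm_real,
      Real.norm_of_nonneg (hqs i).1.le, mul_one, dist_eq_norm]
  have hKO : K ⊆ closure O := attractor_subset_closure hqs hdist hKc hKinv.subset hOne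
    fun i x hx => hOinv (mem_iUnion.2 ⟨i, mem_image_of_mem _ hx⟩)
  have hintO : interior (convexHull ℝ K) ⊆ O := by
    refine (interior_mono (convexHull_min hKO hOconv.closure)).trans ?_
    rw [hOconv.interior_closure_eq_interior_of_nonempty_interior (by rwa [hOo.interior_eq]),
      hOo.interior_eq]
  have hinterior : ∀ i, interior (φ i '' convexHull ℝ K) = φ i '' interior (convexHull ℝ K) :=
    fun i => by rw [← he, (e i).image_interior]
  have himage : ∀ i, φ i '' convexHull ℝ K = convexHull ℝ (φ i '' K) := fun i => by
    rw [← hA, AffineMap.image_convexHull]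
  have hCc := isCompact_convexHull_of_finiteDimensional hKc
  have hmain := sum_card_components_inter_frontier_le (C := convexHull ℝ K)
    (B := fun i => φ i '' convexHull ℝ K) (by simpa using hn) (convex_convexHull ℝ K)
    hCc (fun i => himage i ▸ convex_convexHull ℝ _)
    (fun i => he i ▸ hCc.image (e i).continuous)
    (fun i => hinterior i ▸ hint.image _)
    (fun i j hij => by
      rw [hinterior, hinterior]
      exact (disjoint_iff_inter_eq_empty.2 (hOdisj i j hij)).mono (image_mono hintO)
        (image_mono hintO))
    (fun i => by
      rw [himage]
      refine convexHull_mono ?_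
      conv_rhs => rw [hKinv]
      exact subset_iUnion (fun i => φ i '' K) i)
    (convexHull_mono (hKinv.subset.trans
      (iUnion_mono fun i => image_mono (subset_convexHull ℝ K))))
  rw [Fintype.card_fin] at hmain
  exact ⟨hmain.1, hmain.2.trans (by omega)⟩
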